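/- arXiv:1510.06379 — 7 statements merged into one kernel-verified Lean document; each statement's English description precedes it below -/
import Mathlib

section
/- For predicates p : X → Prop, p' : Y → Prop and relations r : X → Y → Prop, r' : Y → Z → Prop, the serial composition of assert/demonic-update predicate transformers satisfies: {p} ; [r] ; {p'} ; [r'] = {fun x => p x ∧ ∀ y, r x y → p' y} ; [r ∘ r'], where (r ∘ r') x z = ∃ y, r x y ∧ r' y z. -/
/-- Assert predicate transformer `{p}`. -/
def assertPT {X : Type*} (p : X → Prop) : (X → Prop) → (X → Prop) :=
  fun q x => p x ∧ q x

/-- Demonic update predicate transformer `[r]`. -/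
def demonicPT {X Y : Type*} (r : X → Y → Prop) : (Y → Prop) → (X → Prop) :=
  fun q x => ∀ y, r x y → q y

/-- Serial composition of predicate transformers `S ; T`. -/
def seqPT {A B C : Type*} (S : (B → Prop) → (A → Prop)) (T : (C → Prop) → (B → Prop)) :
    (C → Prop) → (A → Prop) := fun q => S (T q)

/-- Relational composition. -/
def relComp {X Y Z : Type*} (r : X → Y → Prop) (r' : Y → Z → Prop) : X → Z → Prop :=
  fun x z => ∃ y, r x y ∧ r' y z

/-- `{p} ; [r] ; {p'} ; [r'] = {fun x => p x ∧ ∀ y, r x y → p' y} ; [r ∘ r']`. -/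
theorem assert_demonic_seq {X Y Z : Type*} (p : X → Prop) (p' : Y → Prop)
    (r : X → Y → Prop) (r' : Y → Z → Prop) :
    seqPT (seqPT (assertPT p) (demonicPT r)) (seqPT (assertPT p') (demonicPT r')) =
      seqPT (assertPT (fun x => p x ∧ ∀ y, r x y → p' y)) (demonicPT (relComp r r')) := by
  funext q x
  apply propext
  constructor
  · rintro ⟨hp, h⟩
    exact ⟨⟨hp, fun y hy => (h y hy).1⟩, fun z ⟨y, hy, hz⟩ => (h y hy).2 z hz⟩
  · rintro ⟨⟨hp, hp'⟩, h⟩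
    exact ⟨hp, fun y hy => ⟨hp' y hy, fun z hz => h z ⟨y, hy, hz⟩⟩⟩
end

section
/- For families of predicates p : I → (X → Prop) and relations r : I → X → Y → Prop, the fusion of the family of predicate transformers (fun i => {p i} ; [r i]) equals {fun x => ∀ i, p i x} ; [fun x y => ∀ i, r i x y]. -/
/-- Fusion of a family of predicate transformers. -/
def FusionPT {I X Y : Type*} (S : I → (Y → Prop) → (X → Prop)) :
    (Y → Prop) → (X → Prop) :=
  fun q x => ∃ p : I → Y → Prop, ((fun y => ∀ i, p i y) ≤ q) ∧ ∀ i, S i (p i) x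

/-- `Fusion (fun i => {p i} ; [r i]) = {fun x => ∀ i, p i x} ; [fun x y => ∀ i, r i x y]`. -/
theorem fusion_assert_demonic {I X Y : Type*} (p : I → X → Prop) (r : I → X → Y → Prop) :
    FusionPT (fun i => seqPT (assertPT (p i)) (demonicPT (r i))) =
      seqPT (assertPT (fun x => ∀ i, p i x)) (demonicPT (fun x y => ∀ i, r i x y)) := by
  funext q x
  refine propext ⟨?_, ?_⟩
  · rintro ⟨s, hs, h⟩
    exact ⟨fun i => (h i).1, fun y hy => hs y fun i => (h i).2 y (hy i)⟩
  · rintro ⟨hp, hq⟩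
    exact ⟨fun i y => r i x y, fun y hy => hq y hy, fun i => ⟨hp i, fun _ hy => hy⟩⟩
end

section
/- For predicates p : X → Prop, p' : X' → Prop and relations r : X → Y → Prop, r' : X' → Y' → Prop, the product of predicate transformers satisfies ({p} ; [r]) × ({p'} ; [r']) = {fun (x, y) => p x ∧ p' y} ; [fun (x, y) (x', y') => r x x' ∧ r' y y']. -/
/-- Product of predicates: `(p × q) (x, x') = p x ∧ q x'`. -/
def prodPred {X X' : Type*} (p : X → Prop) (q : X' → Prop) : X × X' → Prop :=
  fun z => p z.1 ∧ q z.2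

/-- Product (parallel composition) of predicate transformers. -/
def prodPT {X Y X' Y' : Type*} (S : (Y → Prop) → (X → Prop))
    (T : (Y' → Prop) → (X' → Prop)) : (Y × Y' → Prop) → (X × X' → Prop) :=
  fun q z => ∃ p r, prodPred p r ≤ q ∧ S p z.1 ∧ T r z.2

/-- `({p} ; [r]) × ({p'} ; [r']) =
    {fun (x, y) => p x ∧ p' y} ; [fun (x, y) (x', y') => r x x' ∧ r' y y']`. -/
theorem prod_assert_demonic {X Y X' Y' : Type*} (p : X → Prop) (p' : X' → Prop)
    (r : X → Y → Prop) (r' : X' → Y' → Prop) :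
    prodPT (seqPT (assertPT p) (demonicPT r)) (seqPT (assertPT p') (demonicPT r')) =
      seqPT (assertPT (fun z : X × X' => p z.1 ∧ p' z.2))
        (demonicPT (fun (z : X × X') (w : Y × Y') => r z.1 w.1 ∧ r' z.2 w.2)) := by
  funext q ⟨x, x'⟩
  refine propext ⟨?_, ?_⟩
  · rintro ⟨a, b, hab, ⟨hp, ha⟩, hp', hb⟩
    exact ⟨⟨hp, hp'⟩, fun w hw => hab w ⟨ha w.1 hw.1, hb w.2 hw.2⟩⟩
  · rintro ⟨⟨hp, hp'⟩, hq⟩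
    exact ⟨r x, r' x', fun w hw => hq w hw, ⟨hp, fun _ h => h⟩, hp', fun _ h => h⟩
end

section
/- For relations with fail R, R' : Option A → Option B → Prop, refinement of the relations corresponds exactly to refinement of their predicate transformers: R ⊑ R' if and only if wp R ⊑ wp R'. -/
/-- Refinement of predicate transformers: `S ⊑ T`. -/
def refinesPT {X Y : Type*} (S T : (Y → Prop) → (X → Prop)) : Prop :=
  ∀ q x, S q x → T q x

/-- A relation with fail from `A` to `B` (with `none` playing the role of `•`). -/
def IsRWF {A B : Type*} (R : Option A → Option B → Prop) : Prop :=
  ∀ y, R none y ↔ y = none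

/-- Refinement of relations with fail. -/
def refinesRWF {A B : Type*} (R R' : Option A → Option B → Prop) : Prop :=
  ∀ x, R x none ∨ ∀ y, R' x y → R x y

/-- The precondition of a relation with fail. -/
def precR {A B : Type*} (R : Option A → Option B → Prop) : A → Prop :=
  fun x => ¬ R (some x) none

/-- The proper relation of a relation with fail. -/
def relR {A B : Type*} (R : Option A → Option B → Prop) : A → B → Prop :=
  fun x y => R (some x) (some y)

/-- The predicate transformer (weakest precondition) of a relation with fail. -/
def wpR {A B : Type*} (R : Option A → Option B → Prop) : (B → Prop) → (A → Prop) :=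
  seqPT (assertPT (precR R)) (demonicPT (relR R))

/-- Refinement of relations with fail corresponds exactly to refinement of their
predicate transformers. -/
theorem refinesRWF_iff_refinesPT_wp {A B : Type*} (R R' : Option A → Option B → Prop)
    (hR : IsRWF R) (hR' : IsRWF R') :
    refinesRWF R R' ↔ refinesPT (wpR R) (wpR R') := by
  constructor
  · rintro h q x ⟨hp, hq⟩
    have hx := (h (some x)).resolve_left hp
    exact ⟨fun hn => hp (hx none hn), fun y hy => hq y (hx (some y) hy)⟩
  · rintro h (_ | x)
    · exact Or.inl ((hR none).2 rfl)
    · refine or_iff_not_imp_left.2 fun hp => ?_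
      obtain ⟨hp', hq⟩ := h (relR R x) x ⟨hp, fun _ hy => hy⟩
      rintro (_ | y) hy
      · exact absurd hy hp'
      · exact hq y hy
end

section
/- Refinement of relations with fail is preserved by reflexive-transitive closure: if R, R' : Option A → Option A → Prop are relations with fail and R ⊑ R', then R* ⊑ R'*. -/
/-- `n`-fold relational composition (`R⁰` is the equality relation). -/
def relPow {X : Type*} (R : X → X → Prop) : ℕ → X → X → Prop
  | 0 => fun x y => x = y
  | n + 1 => relComp R (relPow R n)

/-- Reflexive-transitive closure: `R* = ⋁ₙ Rⁿ`. -/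
def relStar {X : Type*} (R : X → X → Prop) : X → X → Prop :=
  fun x y => ∃ n, relPow R n x y

theorem relStar_head {X : Type*} {R : X → X → Prop} {x y z : X} (hxy : R x y)
    (hyz : relStar R y z) : relStar R x z := by
  obtain ⟨n, hn⟩ := hyz
  exact ⟨n + 1, y, hxy, hn⟩

theorem relStar_none_or_of_relPow {A : Type*} {R R' : Option A → Option A → Prop}
    (h : refinesRWF R R') (n : ℕ) {x y : Option A} (hxy : relPow R' n x y) :
    relStar R x none ∨ relStar R x y := by
  induction n generalizing x with
  | zero => exact Or.inr ⟨0, hxy⟩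
  | succ n ih =>
    obtain ⟨z, hxz, hzy⟩ := hxy
    rcases h x with hx | hx
    · exact Or.inl (relStar_head hx ⟨0, rfl⟩)
    · exact (ih hzy).imp (relStar_head (hx z hxz)) (relStar_head (hx z hxz))

/-- Refinement of relations with fail is preserved by reflexive-transitive closure. -/
theorem refinesRWF_star {A : Type*} (R R' : Option A → Option A → Prop)
    (hR : IsRWF R) (hR' : IsRWF R') (h : refinesRWF R R') :
    refinesRWF (relStar R) (relStar R') := by
  intro x
  refine or_iff_not_imp_left.mpr fun hx y => ?_
  rintro ⟨n, hn⟩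
  exact (relStar_none_or_of_relPow h n hn).resolve_left hx
end

section
/- For deterministic, input-receptive systems instantaneous feedback computes the least fixpoint: let A = Option A₀ carry the flat order, let f : B → A → A and g : B → A → C be total functions with f x monotone for every x, and let R : Option (A × B) → Option (A × C) → Prop be the relation with fail with R (some (u, x)) z ↔ z = some (f x u, g x u) (and R none y ↔ y = none). Then for all x, u, y: InstFeedback R (some x) (some (u, y)) holds if and only if u is the least fixpoint of f x (i.e. f x u = u and u ≤ w for every w with f x w = w) and y = g x u. -/
/-- The flat order on `Option A` (with `⊥ = none`): `a ≤ b ↔ a = ⊥ ∨ a = b`. -/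
def flatLE {A : Type*} (a b : Option A) : Prop := a = none ∨ a = b

/-- Strict flat order on `Option A`. -/
def flatLT {A : Type*} (a b : Option A) : Prop := flatLE a b ∧ a ≠ b

/-- Instantaneous feedback of a relation with fail and unknown. -/
def InstFeedback {A B C : Type*}
    (R : Option (Option A × B) → Option (Option A × C) → Prop) :
    Option B → Option (Option A × C) → Prop
  | none, y => y = none
  | some x, none =>
      ∃ (n : ℕ) (u : ℕ → Option A), u 0 = none ∧ R (some (u n, x)) none ∧
        ∀ i < n, flatLT (u i) (u (i + 1)) ∧ ∃ z, R (some (u i, x)) (some (u (i + 1), z))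
  | some x, some (v, y) =>
      ∃ (n : ℕ) (u : ℕ → Option A), u 0 = none ∧ u n = v ∧
        R (some (v, x)) (some (v, y)) ∧
        ∀ i < n, flatLT (u i) (u (i + 1)) ∧ ∃ z, R (some (u i, x)) (some (u (i + 1), z))

/-- For deterministic, input-receptive systems (total functions monotone with respect to
the flat order), instantaneous feedback computes the least fixpoint. -/
theorem instFeedback_deterministic_lfp {A B C : Type*}
    (f : B → Option A → Option A) (g : B → Option A → C)
    (hmono : ∀ (x : B), ∀ a b : Option A, flatLE a b → flatLE (f x a) (f x b))
    (R : Option (Option A × B) → Option (Option A × C) → Prop)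
    (hRnone : ∀ y, R none y ↔ y = none)
    (hRfun : ∀ (u : Option A) (x : B) (z : Option (Option A × C)),
      R (some (u, x)) z ↔ z = some (f x u, g x u)) :
    ∀ (x : B) (u : Option A) (y : C),
      InstFeedback R (some x) (some (u, y)) ↔
        (f x u = u ∧ (∀ w : Option A, f x w = w → flatLE u w)) ∧ y = g x u := by
  intro x u y
  simp only [InstFeedback, hRfun, Option.some.injEq, Prod.mk.injEq]
  constructor
  · rintro ⟨n, s, h0, rfl, ⟨hfix, hy⟩, hstep⟩
    refine ⟨⟨hfix.symm, fun w hw => ?_⟩, hy⟩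
    have hle : ∀ i ≤ n, flatLE (s i) w := by
      intro i
      induction i with
      | zero => exact fun _ => Or.inl h0
      | succ i ih =>
        intro hi
        obtain ⟨-, z, hz, -⟩ := hstep i hi
        rw [hz, ← hw]
        exact hmono x _ _ (ih (by omega))
    exact hle n le_rfl
  · rintro ⟨⟨hfix, hleast⟩, rfl⟩
    by_cases hu : u = none
    · exact ⟨0, fun _ => none, rfl, hu.symm, ⟨hfix.symm, rfl⟩, fun i hi => by omega⟩
    · have hbot : f x none ≠ none := fun h => by
        rcases hleast none h with h' | h' <;> exact hu h'
      have hf : f x none = u := by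
        rcases hmono x none u (Or.inl rfl) with h | h
        · exact absurd h hbot
        · exact h.trans hfix
      refine ⟨1, fun i => if i = 0 then none else u, rfl, rfl, ⟨hfix.symm, rfl⟩, ?_⟩
      intro i hi
      obtain rfl : i = 0 := by omega
      exact ⟨⟨Or.inl rfl, fun h => hu h.symm⟩, g x none, hf.symm, rfl⟩
end

section
/- For a property p : X^ω → Prop and a relation r on X^ω, IterateNextOmega ({p} ; [r]) = {fun x => ∀ n y, IterateRel idnext r n x y → (○ⁿ p) y} ; [fun x z => ∀ n, ∃ y, IterateRel idnext r n x y ∧ eqtop n y z], i.e. the assert of the property that every iteratively reachable sequence satisfies the n-shifted precondition, followed by the demonic update of the intersection over n of the relations IterateRel idnext r n ∘ eqtop n. -/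
/-- `Skip`, the identity transformer. -/
def skipPT {X : Type*} : (X → Prop) → (X → Prop) := id

/-- Demonic update of the graph of a function: `[x ↝ f x]`. -/
def graphPT {X Y : Type*} (f : X → Y) : (Y → Prop) → (X → Prop) :=
  demonicPT (fun x y => y = f x)

/-- Shift of an infinite sequence: `xⁿ i = x (n + i)`. -/
def shiftSeq {X : Type*} (x : ℕ → X) (n : ℕ) : ℕ → X := fun i => x (n + i)

/-- `z · w`: the sequence with head `z` and tail `w`. -/
def consSeq {X : Type*} (z : X) (w : ℕ → X) : ℕ → X
  | 0 => z
  | n + 1 => w n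

/-- `SkipNext S = [x ↝ (x₀, x¹)] ; (Skip × S) ; [(z, w) ↝ z·w]`. -/
def SkipNext {X : Type*} (S : ((ℕ → X) → Prop) → ((ℕ → X) → Prop)) :
    ((ℕ → X) → Prop) → ((ℕ → X) → Prop) :=
  seqPT (seqPT (graphPT (fun x : ℕ → X => (x 0, shiftSeq x 1))) (prodPT skipPT S))
    (graphPT (fun zw : X × (ℕ → X) => consSeq zw.1 zw.2))

/-- `eqtop n x y`: the sequences `x` and `y` agree on their first `n` elements. -/
def eqtop {X : Type*} (n : ℕ) (x y : ℕ → X) : Prop := ∀ i < n, x i = y i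

/-- `idnext r x y = r x¹ y¹ ∧ eqtop 1 x y`. -/
def idnext {X : Type*} (r : (ℕ → X) → (ℕ → X) → Prop) (x y : ℕ → X) : Prop :=
  r (shiftSeq x 1) (shiftSeq y 1) ∧ eqtop 1 x y

/-- `(○ p) x = p x¹`: the "next" temporal operator. -/
def nextProp {X : Type*} (p : (ℕ → X) → Prop) (x : ℕ → X) : Prop :=
  p (shiftSeq x 1)

/-- `SkipTop n = [x ↝ y | eqtop n x y]`. -/
def SkipTop {X : Type*} (n : ℕ) : ((ℕ → X) → Prop) → ((ℕ → X) → Prop) :=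
  demonicPT (eqtop n)

/-- `Iterate F S n = S ; F S ; ⋯ ; F^{n-1} S` (with `Iterate F S 0 = Skip`). -/
def IteratePT {W : Type*}
    (F : ((W → Prop) → (W → Prop)) → ((W → Prop) → (W → Prop)))
    (S : (W → Prop) → (W → Prop)) : ℕ → (W → Prop) → (W → Prop)
  | 0 => id
  | n + 1 => seqPT (IteratePT F S n) (F^[n] S)

/-- `IterateOmega F S = Fusion (fun n => Iterate F S n ; SkipTop n)`. -/
def IterateOmega {X : Type*}
    (F : (((ℕ → X) → Prop) → ((ℕ → X) → Prop)) → (((ℕ → X) → Prop) → ((ℕ → X) → Prop)))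
    (S : ((ℕ → X) → Prop) → ((ℕ → X) → Prop)) :
    ((ℕ → X) → Prop) → ((ℕ → X) → Prop) :=
  FusionPT (fun n : ℕ => seqPT (IteratePT F S n) (SkipTop n))

/-- `IterateNextOmega S = IterateOmega SkipNext S`. -/
def IterateNextOmega {X : Type*} (S : ((ℕ → X) → Prop) → ((ℕ → X) → Prop)) :
    ((ℕ → X) → Prop) → ((ℕ → X) → Prop) :=
  IterateOmega SkipNext S

/-- `IterateRel R r n = r ∘ R r ∘ ⋯ ∘ R^{n-1} r` (with `IterateRel R r 0` equality). -/
def IterateRel {W : Type*} (R : (W → W → Prop) → (W → W → Prop)) (r : W → W → Prop) :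
    ℕ → W → W → Prop
  | 0 => fun x y => x = y
  | n + 1 => relComp (IterateRel R r n) (R^[n] r)

theorem skipNext_apply {X : Type*} {S : ((ℕ → X) → Prop) → ((ℕ → X) → Prop)}
    (hS : Monotone S) (q : (ℕ → X) → Prop) (x : ℕ → X) :
    SkipNext S q x ↔ S (fun w => q (consSeq (x 0) w)) (shiftSeq x 1) := by
  constructor
  · intro h
    obtain ⟨a, b, hab, ha, hb⟩ := h _ rfl
    exact hS (fun w hw => hab (x 0, w) ⟨ha, hw⟩ _ rfl) _ hb
  · rintro h _ rfl
    refine ⟨fun u => u = x 0, _, ?_, rfl, h⟩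
    rintro ⟨u, w⟩ ⟨rfl, hw⟩ _ rfl
    exact hw

theorem monotone_assert_demonic {X Y : Type*} (p : X → Prop) (r : X → Y → Prop) :
    Monotone (seqPT (assertPT p) (demonicPT r)) :=
  fun _ _ h _ hx => ⟨hx.1, fun y hy => h y (hx.2 y hy)⟩

theorem consSeq_head_shiftSeq {X : Type*} (x : ℕ → X) :
    consSeq (x 0) (shiftSeq x 1) = x := by
  funext i
  cases i with
  | zero => rfl
  | succ n => exact congrArg x (Nat.add_comm 1 n)

theorem shiftSeq_consSeq {X : Type*} (a : X) (w : ℕ → X) :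
    shiftSeq (consSeq a w) 1 = w := by
  funext i
  simp [shiftSeq, Nat.add_comm 1 i, consSeq]

theorem shiftSeq_shiftSeq {X : Type*} (x : ℕ → X) (m n : ℕ) :
    shiftSeq (shiftSeq x m) n = shiftSeq x (m + n) := by
  funext i
  simp [shiftSeq, Nat.add_assoc]

theorem skipNext_assert_demonic {X : Type*}
    (p : (ℕ → X) → Prop) (r : (ℕ → X) → (ℕ → X) → Prop) :
    SkipNext (seqPT (assertPT p) (demonicPT r)) =
      seqPT (assertPT (nextProp p)) (demonicPT (idnext r)) := by
  funext q x
  refine propext ((skipNext_apply (monotone_assert_demonic p r) q x).trans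
    (and_congr_right fun _ => ⟨fun h y hy => ?_, fun h w hw => h _ ⟨?_, ?_⟩⟩))
  · have hq := h _ hy.1
    rwa [hy.2 0 Nat.one_pos, consSeq_head_shiftSeq] at hq
  · rwa [shiftSeq_consSeq]
  · intro i hi
    obtain rfl := Nat.lt_one_iff.mp hi
    rfl

theorem iterate_skipNext_assert_demonic {X : Type*}
    (p : (ℕ → X) → Prop) (r : (ℕ → X) → (ℕ → X) → Prop) (n : ℕ) :
    SkipNext^[n] (seqPT (assertPT p) (demonicPT r)) =
      seqPT (assertPT fun x => p (shiftSeq x n)) (demonicPT (idnext^[n] r)) := by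
  induction n with
  | zero =>
    have h : (fun x => p (shiftSeq x 0)) = p := by
      funext x
      exact congrArg p (funext fun i => congrArg x (Nat.zero_add i))
    rw [h]
    rfl
  | succ n ih =>
    have h : nextProp (fun x => p (shiftSeq x n)) = fun x => p (shiftSeq x (n + 1)) := by
      funext x
      rw [nextProp, shiftSeq_shiftSeq, Nat.add_comm]
    rw [Function.iterate_succ_apply', ih, skipNext_assert_demonic, h,
      Function.iterate_succ_apply']

theorem iteratePT_skipNext_assert_demonic {X : Type*}
    (p : (ℕ → X) → Prop) (r : (ℕ → X) → (ℕ → X) → Prop) (n : ℕ)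
    (q : (ℕ → X) → Prop) (x : ℕ → X) :
    IteratePT SkipNext (seqPT (assertPT p) (demonicPT r)) n q x ↔
      (∀ m < n, ∀ y, IterateRel idnext r m x y → p (shiftSeq y m)) ∧
        ∀ y, IterateRel idnext r n x y → q y := by
  induction n generalizing q with
  | zero => simp [IteratePT, IterateRel]
  | succ n ih =>
    rw [IteratePT, iterate_skipNext_assert_demonic]
    refine (ih _).trans ?_
    simp only [seqPT, assertPT, demonicPT, IterateRel, relComp, Nat.lt_succ_iff_lt_or_eq]
    constructor
    · rintro ⟨hp, hq⟩
      refine ⟨?_, fun z ⟨y, hy, hz⟩ => (hq y hy).2 z hz⟩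
      rintro m (hm | rfl) y hy
      exacts [hp m hm y hy, (hq y hy).1]
    · rintro ⟨hp, hq⟩
      exact ⟨fun m hm => hp m (Or.inl hm),
        fun y hy => ⟨hp n (Or.inr rfl) y hy, fun z hz => hq z ⟨y, hy, hz⟩⟩⟩

/-- `IterateNextOmega ({p} ; [r])` computed explicitly: the assert that every iteratively
reachable sequence satisfies the shifted precondition, followed by the demonic update of
the intersection over `n` of `IterateRel idnext r n ∘ eqtop n`. -/
theorem iterateNextOmega_assert_demonic {X : Type*}
    (p : (ℕ → X) → Prop) (r : (ℕ → X) → (ℕ → X) → Prop) :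
    IterateNextOmega (seqPT (assertPT p) (demonicPT r)) =
      seqPT
        (assertPT (fun x : ℕ → X =>
          ∀ (n : ℕ) (y : ℕ → X), IterateRel idnext r n x y → p (shiftSeq y n)))
        (demonicPT (fun x z : ℕ → X =>
          ∀ n : ℕ, ∃ y : ℕ → X, IterateRel idnext r n x y ∧ eqtop n y z)) := by
  funext q x
  refine propext ⟨?_, ?_⟩
  · rintro ⟨P, hPq, hP⟩
    have h n := (iteratePT_skipNext_assert_demonic p r n _ x).mp (hP n)
    refine ⟨fun n y hy => (h (n + 1)).1 n n.lt_succ_self y hy, fun z hz => hPq z fun n => ?_⟩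
    obtain ⟨y, hy, hyz⟩ := hz n
    exact (h n).2 y hy z hyz
  · rintro ⟨hp, hq⟩
    refine ⟨fun n z => ∃ y, IterateRel idnext r n x y ∧ eqtop n y z, hq, fun n => ?_⟩
    exact (iteratePT_skipNext_assert_demonic p r n _ x).mpr
      ⟨fun m _ => hp m, fun y hy z hyz => ⟨y, hy, hyz⟩⟩
end
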